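/- Let A = A₁ + iA₂ ∈ ℂ^{m×m} with A₁, A₂ real. Then for every s ∈ ℂ, det(s·I_{2m} − A_σ) = det(s²·Iₘ − AĀ) = det(s²·Iₘ − ĀA), where the real matrix A_σ is regarded as a complex matrix. -/

import Mathlib

open Matrix

/-- Entrywise complex conjugate. -/
def conjM {m n : ℕ} (A : Matrix (Fin m) (Fin n) ℂ) : Matrix (Fin m) (Fin n) ℂ :=
  A.map (starRingEnd ℂ)

/-- The real representation `A_σ = [[A₁, A₂], [A₂, −A₁]]` of `A = A₁ + iA₂`,
regarded as a complex matrix. -/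
def sigmaM {m n : ℕ} (A : Matrix (Fin m) (Fin n) ℂ) :
    Matrix (Fin m ⊕ Fin m) (Fin n ⊕ Fin n) ℂ :=
  Matrix.fromBlocks (A.map fun z => (z.re : ℂ)) (A.map fun z => (z.im : ℂ))
    (A.map fun z => (z.im : ℂ)) (-(A.map fun z => (z.re : ℂ)))

/-- The determinant of a block matrix with equal scalar diagonal blocks, for a regular scalar. -/
theorem det_fromBlocks_smul_one_of_isRegular {R n : Type*} [CommRing R] [Fintype n]
    [DecidableEq n] (B C : Matrix n n R) {s : R} (hs : IsRegular s) :
    (fromBlocks (s • 1) B C (s • 1)).det = (s ^ 2 • (1 : Matrix n n R) - B * C).det := by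
  have h : fromBlocks (s • 1) B C (s • 1) * fromBlocks (s • 1) 0 (-C) 1 =
      fromBlocks (s ^ 2 • (1 : Matrix n n R) - B * C) B 0 (s • 1) := by
    rw [fromBlocks_multiply]
    simp [pow_two, mul_smul, sub_eq_add_neg]
  have hdet := congrArg det h
  rw [det_mul, det_fromBlocks_zero₁₂, det_fromBlocks_zero₂₁, det_one, mul_one, det_smul,
    det_one, mul_one] at hdet
  exact (hs.pow _).right hdet

/-- The determinant of a block matrix with equal scalar diagonal blocks. -/
theorem det_fromBlocks_smul_one {R n : Type*} [CommRing R] [Fintype n] [DecidableEq n]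
    (B C : Matrix n n R) (s : R) :
    (fromBlocks (s • 1) B C (s • 1)).det = (s ^ 2 • (1 : Matrix n n R) - B * C).det := by
  have h := congrArg (Polynomial.evalRingHom s)
    (det_fromBlocks_smul_one_of_isRegular (B.map Polynomial.C) (C.map Polynomial.C)
      (s := Polynomial.X) Polynomial.isRegular_X)
  rw [RingHom.map_det, RingHom.map_det] at h
  have e₁ : (Polynomial.evalRingHom s).mapMatrix (fromBlocks ((Polynomial.X : Polynomial R) • 1)
      (B.map Polynomial.C) (C.map Polynomial.C) ((Polynomial.X : Polynomial R) • 1)) =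
      fromBlocks (s • 1) B C (s • 1) := by
    ext (i | i) (j | j) <;> simp [one_apply, apply_ite (Polynomial.eval s)]
  have e₂ : (Polynomial.evalRingHom s).mapMatrix
      ((Polynomial.X : Polynomial R) ^ 2 • (1 : Matrix n n (Polynomial R)) -
        B.map Polynomial.C * C.map Polynomial.C) = s ^ 2 • (1 : Matrix n n R) - B * C := by
    ext i j
    simp [one_apply, mul_apply, Polynomial.eval_finsetSum, apply_ite (Polynomial.eval s)]
  rwa [e₁, e₂] at h

/-- The change of basis that turns the real representation into a block antidiagonal matrix. -/
def realRepBasis (m : ℕ) : Matrix (Fin m ⊕ Fin m) (Fin m ⊕ Fin m) ℂ :=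
  fromBlocks 1 (Complex.I • 1) 1 (-(Complex.I • 1))

theorem det_realRepBasis_ne_zero (m : ℕ) : (realRepBasis m).det ≠ 0 := by
  have h : (realRepBasis m).det = (-(2 * Complex.I)) ^ m := by
    rw [realRepBasis, det_fromBlocks_one₁₁, one_mul, ← neg_smul, ← sub_smul, det_smul]
    simp
    ring
  rw [h]
  exact pow_ne_zero _ (by simp)

theorem realRepBasis_mul_sigmaM {m : ℕ} (A : Matrix (Fin m) (Fin m) ℂ) :
    realRepBasis m * sigmaM A = fromBlocks 0 A (conjM A) 0 * realRepBasis m := by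
  rw [realRepBasis, sigmaM, fromBlocks_multiply, fromBlocks_multiply]
  ext (i | i) (j | j) <;> simp [conjM, Complex.ext_iff]

/-- `det(s·I_{2m} − A_σ) = det(s²·Iₘ − AĀ) = det(s²·Iₘ − ĀA)`. -/
theorem det_sigma {m : ℕ} (A : Matrix (Fin m) (Fin m) ℂ) (s : ℂ) :
    (s • (1 : Matrix (Fin m ⊕ Fin m) (Fin m ⊕ Fin m) ℂ) - sigmaM A).det =
        (s ^ 2 • (1 : Matrix (Fin m) (Fin m) ℂ) - A * conjM A).det ∧
    (s ^ 2 • (1 : Matrix (Fin m) (Fin m) ℂ) - A * conjM A).det =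
        (s ^ 2 • (1 : Matrix (Fin m) (Fin m) ℂ) - conjM A * A).det := by
  refine ⟨?_, ?_⟩
  · have h : realRepBasis m * (s • 1 - sigmaM A) =
        fromBlocks (s • 1) (-A) (-conjM A) (s • 1) * realRepBasis m := by
      rw [mul_sub, realRepBasis_mul_sigmaM]
      have e : fromBlocks (s • 1) (-A) (-conjM A) (s • 1) =
          s • (1 : Matrix (Fin m ⊕ Fin m) (Fin m ⊕ Fin m) ℂ) -
            fromBlocks 0 A (conjM A) 0 := by
        rw [← fromBlocks_one, fromBlocks_smul, sub_eq_add_neg, fromBlocks_neg, fromBlocks_add]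
        simp
      rw [e, sub_mul]
      simp
    have hdet := congrArg det h
    rw [det_mul, det_mul, mul_comm] at hdet
    rw [mul_right_cancel₀ (det_realRepBasis_ne_zero m) hdet, det_fromBlocks_smul_one]
    simp
  · simpa [eval_charpoly, smul_one_eq_diagonal] using
      congrArg (Polynomial.eval (s ^ 2)) (charpoly_mul_comm A (conjM A))
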